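/- Let 1 < p < ∞, let h ∈ H^p(𝔻), let ψ : 𝔻 → 𝔻 be holomorphic, and suppose the weighted composition operator W_{h,ψ} is bounded on H^p. Then the following are equivalent: (i) W_{h,ψ} is bounded below on H^p; (ii) there exists a constant C > 0 such that ‖W_{h,ψ} k_λ‖_p ≥ C ‖k_λ‖_p for all λ ∈ 𝔻, where k_λ(z) = 1/(1 - λ̄ z). -/

import Mathlib

open MeasureTheory Metric Complex

noncomputable section

/-- Normalized Lebesgue (arc length) measure on the unit circle `𝕋`, as a Borel measure on `ℂ`. -/
def circleM : Measure ℂ :=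
  (ENNReal.ofReal (2 * Real.pi))⁻¹ •
    (volume.restrict (Set.Ioc (0 : ℝ) (2 * Real.pi))).map
      (fun θ : ℝ => Complex.exp (θ * Complex.I))

/-- The Hardy space `p`-norm of a function on the unit disc, namely
`sup_{0 ≤ r < 1} (∫_𝕋 ‖f (r ζ)‖^p dm(ζ))^{1/p}`. -/
def hardyNorm (p : ℝ) (f : ℂ → ℂ) : ℝ :=
  ⨆ r : Set.Ico (0 : ℝ) 1, (∫ ζ, ‖f (((r : ℝ) : ℂ) * ζ)‖ ^ p ∂circleM) ^ (1 / p)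

/-- Membership in the Hardy space `H^p` of the unit disc: `f` is holomorphic on `𝔻` and its
`p`-means over circles of radius `r < 1` are uniformly bounded. -/
def MemHp (p : ℝ) (f : ℂ → ℂ) : Prop :=
  DifferentiableOn ℂ f (ball (0 : ℂ) 1) ∧
    BddAbove (Set.range fun r : Set.Ico (0 : ℝ) 1 =>
      (∫ ζ, ‖f (((r : ℝ) : ℂ) * ζ)‖ ^ p ∂circleM) ^ (1 / p))

/-- The reproducing kernel of the Hardy space: `k_λ(z) = 1/(1 - conj λ * z)`. -/
def kern (l z : ℂ) : ℂ := (1 - (starRingEnd ℂ) l * z)⁻¹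

theorem circleM_univ : circleM Set.univ = 1 := by
  have hm : Measurable (fun θ : ℝ => Complex.exp (θ * Complex.I)) := by fun_prop
  have h2 : (0 : ℝ) < 2 * Real.pi := by positivity
  rw [circleM, Measure.smul_apply, Measure.map_apply hm MeasurableSet.univ]
  simp only [Set.preimage_univ, Measure.restrict_apply MeasurableSet.univ, Set.univ_inter,
    Real.volume_Ioc, sub_zero, smul_eq_mul]
  exact ENNReal.inv_mul_cancel (by simpa using h2) ENNReal.ofReal_ne_top

instance : IsProbabilityMeasure circleM := ⟨circleM_univ⟩

theorem ae_circleM_mem_sphere : ∀ᵐ ζ ∂circleM, ζ ∈ sphere (0 : ℂ) 1 := by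
  have hm : Measurable (fun θ : ℝ => Complex.exp (θ * Complex.I)) := by fun_prop
  refine Measure.ae_smul_measure ?_ _
  refine (ae_map_iff hm.aemeasurable (p := fun ζ => ζ ∈ sphere (0 : ℂ) 1)
    isClosed_sphere.measurableSet).2 ?_
  exact Filter.Eventually.of_forall fun θ => by simp [Complex.norm_exp_ofReal_mul_I]

theorem circleM_restrict_sphere : circleM.restrict (sphere (0 : ℂ) 1) = circleM :=
  Measure.restrict_eq_self_of_ae_mem ae_circleM_mem_sphere

theorem ContinuousOn.integrable_circleM {E : Type*} [NormedAddCommGroup E] {g : ℂ → E}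
    (hg : ContinuousOn g (sphere (0 : ℂ) 1)) : Integrable g circleM := by
  have : IntegrableOn g (sphere (0 : ℂ) 1) circleM :=
    hg.integrableOn_compact (isCompact_sphere 0 1)
  rwa [IntegrableOn, circleM_restrict_sphere] at this

theorem integral_circleM_eq_circleAverage {E : Type*} [NormedAddCommGroup E] [NormedSpace ℝ E]
    {g : ℂ → E} (hg : ContinuousOn g (sphere (0 : ℂ) 1)) :
    ∫ ζ, g ζ ∂circleM = Real.circleAverage g 0 1 := by
  have hm : Measurable (fun θ : ℝ => Complex.exp (θ * Complex.I)) := by fun_prop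
  have h2 : (0 : ℝ) < 2 * Real.pi := by positivity
  have hi := hg.integrable_circleM.aestronglyMeasurable
  rw [circleM] at hi ⊢
  rw [integral_smul_measure, integral_map hm.aemeasurable, Real.circleAverage_def,
    intervalIntegral.integral_of_le h2.le, ENNReal.toReal_inv, ENNReal.toReal_ofReal h2.le]
  · simp [circleMap]
  · refine hi.mono_ac (Measure.absolutelyContinuous_smul ?_)
    exact ENNReal.inv_ne_zero.2 ENNReal.ofReal_ne_top

theorem integral_circleM_rotate {E : Type*} [NormedAddCommGroup E] [NormedSpace ℝ E]
    {g : ℂ → E} (hg : ContinuousOn g (sphere (0 : ℂ) 1)) {u : ℂ} (hu : ‖u‖ = 1) :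
    ∫ ζ, g (u * ζ) ∂circleM = ∫ ζ, g ζ ∂circleM := by
  have hg' : ContinuousOn (fun ζ => g (u * ζ)) (sphere (0 : ℂ) 1) :=
    hg.comp (by fun_prop) (fun ζ hζ => by simpa [hu] using hζ)
  rw [integral_circleM_eq_circleAverage hg, integral_circleM_eq_circleAverage hg',
    Real.circleAverage_eq_integral_add (f := g) (arg u), Real.circleAverage_def]
  congr 2
  ext θ
  have : u = Complex.exp (arg u * Complex.I) := by
    conv_lhs => rw [← Complex.norm_mul_exp_arg_mul_I u, hu]
    simp
  congr 1
  simp only [circleMap]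
  conv_lhs => rw [this]
  push_cast
  rw [add_mul, Complex.exp_add]
  simp [mul_comm]

theorem integral_circleM_prod_swap {g : ℂ → ℂ → ℝ}
    (hg : ContinuousOn (fun x : ℂ × ℂ => g x.1 x.2) (sphere (0 : ℂ) 1 ×ˢ sphere (0 : ℂ) 1)) :
    Integrable (fun ζ => ∫ η, g ζ η ∂circleM) circleM ∧
      ∫ ζ, ∫ η, g ζ η ∂circleM ∂circleM = ∫ η, ∫ ζ, g ζ η ∂circleM ∂circleM := by
  have hi : Integrable (fun x : ℂ × ℂ => g x.1 x.2) (circleM.prod circleM) := by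
    have : IntegrableOn (fun x : ℂ × ℂ => g x.1 x.2) (sphere (0 : ℂ) 1 ×ˢ sphere (0 : ℂ) 1)
        (circleM.prod circleM) :=
      hg.integrableOn_compact ((isCompact_sphere 0 1).prod (isCompact_sphere 0 1))
    rwa [IntegrableOn, ← Measure.prod_restrict, circleM_restrict_sphere] at this
  exact ⟨hi.integral_prod_left, integral_integral_swap hi⟩

/-- The `p`-th power mean of `f` over the circle of radius `r`. -/
def circleMean (p : ℝ) (f : ℂ → ℂ) (r : ℝ) : ℝ := ∫ ζ, ‖f ((r : ℂ) * ζ)‖ ^ p ∂circleM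

theorem mul_mem_ball_of_mem_sphere {r : ℝ} (hr : r ∈ Set.Ico (0 : ℝ) 1) {ζ : ℂ}
    (hζ : ζ ∈ sphere (0 : ℂ) 1) : (r : ℂ) * ζ ∈ ball (0 : ℂ) 1 := by
  simp only [mem_sphere_iff_norm, sub_zero] at hζ
  simp [hζ, abs_of_nonneg hr.1, hr.2]

theorem continuousOn_comp_mul {E : Type*} [TopologicalSpace E] {f : ℂ → E}
    (hf : ContinuousOn f (ball (0 : ℂ) 1)) {r : ℝ}
    (hr : r ∈ Set.Ico (0 : ℝ) 1) : ContinuousOn (fun ζ => f ((r : ℂ) * ζ)) (sphere (0 : ℂ) 1) :=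
  hf.comp (by fun_prop) fun _ hζ => mul_mem_ball_of_mem_sphere hr hζ

theorem continuousOn_norm_rpow_comp_mul {p : ℝ} (hp : 0 ≤ p) {f : ℂ → ℂ}
    (hf : ContinuousOn f (ball (0 : ℂ) 1)) {r : ℝ} (hr : r ∈ Set.Ico (0 : ℝ) 1) :
    ContinuousOn (fun ζ => ‖f ((r : ℂ) * ζ)‖ ^ p) (sphere (0 : ℂ) 1) :=
  (continuousOn_comp_mul hf hr).norm.rpow_const fun _ _ => Or.inr hp

theorem circleMean_nonneg (p : ℝ) (f : ℂ → ℂ) (r : ℝ) : 0 ≤ circleMean p f r :=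
  integral_nonneg fun _ => by positivity

theorem memLp_circleM {f : ℂ → ℂ} (hf : ContinuousOn f (sphere (0 : ℂ) 1)) (q : ENNReal) :
    MemLp f q circleM := by
  obtain ⟨C, hC⟩ := (isCompact_sphere (0 : ℂ) 1).exists_bound_of_continuousOn hf
  exact MemLp.of_bound hf.integrable_circleM.aestronglyMeasurable C
    (ae_circleM_mem_sphere.mono hC)

/-- A Cauchy-type integral against a bounded weight is holomorphic. -/
theorem differentiableOn_integral_circleM {f g : ℂ → ℂ} (hf : DifferentiableOn ℂ f (ball (0 : ℂ) 1))
    (hg : AEStronglyMeasurable g circleM) {K : ℝ} (hK : ∀ᵐ ζ ∂circleM, ‖g ζ‖ ≤ K) :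
    DifferentiableOn ℂ (fun z => ∫ ζ, f (z * ζ) * g ζ ∂circleM) (ball (0 : ℂ) 1) := by
  intro z₀ hz₀
  have hz₀' : ‖z₀‖ < 1 := by simpa using hz₀
  obtain ⟨t, ht1, ht2⟩ := exists_between hz₀'
  have hd : DifferentiableOn ℂ (deriv f) (ball (0 : ℂ) 1) := hf.deriv isOpen_ball
  have hsub : closedBall (0 : ℂ) t ⊆ ball (0 : ℂ) 1 := closedBall_subset_ball ht2
  obtain ⟨C, hC⟩ := (isCompact_closedBall (0 : ℂ) t).exists_bound_of_continuousOn
    (hd.continuousOn.mono hsub)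
  have hmem : ∀ z ∈ ball (0 : ℂ) t, ∀ ζ ∈ sphere (0 : ℂ) 1, z * ζ ∈ closedBall (0 : ℂ) t := by
    intro z hz ζ hζ
    simp only [mem_sphere_iff_norm, sub_zero] at hζ
    simp only [mem_ball_zero_iff] at hz
    simp [hζ, hz.le]
  have hcont : ∀ (F : ℂ → ℂ), ContinuousOn F (ball (0 : ℂ) 1) → ∀ z ∈ ball (0 : ℂ) t,
      ContinuousOn (fun ζ => F (z * ζ)) (sphere (0 : ℂ) 1) := fun F hF z hz =>
    hF.comp (by fun_prop) fun ζ hζ => hsub (hmem z hz ζ hζ)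
  have hz₀t : z₀ ∈ ball (0 : ℂ) t := by simpa using ht1
  have hnhds : ball (0 : ℂ) t ∈ nhds z₀ := isOpen_ball.mem_nhds hz₀t
  have hC0 : 0 ≤ C := (norm_nonneg _).trans (hC z₀ (ball_subset_closedBall hz₀t))
  refine DifferentiableAt.differentiableWithinAt (HasDerivAt.differentiableAt
    (hasDerivAt_integral_of_dominated_loc_of_deriv_le (μ := circleM) (bound := fun _ => C * K)
      (F := fun z ζ => f (z * ζ) * g ζ)
      (F' := fun z ζ => deriv f (z * ζ) * ζ * g ζ) hnhds ?_ ?_ ?_ ?_ (integrable_const _) ?_).2)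
  · filter_upwards [hnhds] with z hz
    exact (hcont f hf.continuousOn z hz).integrable_circleM.aestronglyMeasurable.mul hg
  · exact (hcont f hf.continuousOn z₀ hz₀t).integrable_circleM.mul_bdd hg hK
  · exact ((hcont _ hd.continuousOn z₀ hz₀t).mul
      continuousOn_id).integrable_circleM.aestronglyMeasurable.mul hg
  · filter_upwards [ae_circleM_mem_sphere, hK] with ζ hζ hgζ z hz
    have h1 := hC _ (hmem z hz ζ hζ)
    simp only [mem_sphere_iff_norm, sub_zero] at hζ
    rw [norm_mul, norm_mul, hζ, mul_one]
    gcongr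
  · filter_upwards [ae_circleM_mem_sphere] with ζ hζ z hz
    have h1 : HasDerivAt f (deriv f (z * ζ)) (z * ζ) :=
      (hf.differentiableAt (isOpen_ball.mem_nhds (hsub (hmem z hz ζ hζ)))).hasDerivAt
    have h2 : HasDerivAt (fun z : ℂ => z * ζ) ζ z := by simpa using (hasDerivAt_id z).mul_const ζ
    exact (h1.comp z h2).mul_const (g ζ)

theorem circleMean_mono {p : ℝ} (hp : 1 < p) {f : ℂ → ℂ}
    (hf : DifferentiableOn ℂ f (ball (0 : ℂ) 1)) :
    MonotoneOn (circleMean p f) (Set.Ico (0 : ℝ) 1) := by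
  intro r hr s hs hrs
  have hpq : p.HolderConjugate (p / (p - 1)) := Real.HolderConjugate.conjExponent hp
  set q := p / (p - 1) with hq
  have hcr := continuousOn_comp_mul hf.continuousOn hr
  set g : ℂ → ℂ := fun ζ => (starRingEnd ℂ) (f (r * ζ)) * ((‖f (r * ζ)‖ ^ (p - 2) : ℝ) : ℂ) with hg
  have hgn : ∀ ζ, ‖g ζ‖ = ‖f (r * ζ)‖ ^ (p - 1) := by
    intro ζ
    have h0 : 0 ≤ ‖f (r * ζ)‖ ^ (p - 2) := by positivity
    rw [hg]
    simp only [norm_mul, RCLike.norm_conj, Complex.norm_real, Real.norm_of_nonneg h0]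
    rcases eq_or_ne (‖f (r * ζ)‖) 0 with h | h
    · rw [h, zero_mul, Real.zero_rpow (by linarith)]
    · have := (norm_nonneg (f (r * ζ))).lt_of_ne' h
      nth_rewrite 1 [← Real.rpow_one ‖f (r * ζ)‖]
      rw [← Real.rpow_add this]
      congr 1; ring
  have hfg : ∀ ζ, f (r * ζ) * g ζ = ((‖f (r * ζ)‖ ^ p : ℝ) : ℂ) := by
    intro ζ
    rw [hg]
    simp only
    rw [← mul_assoc, Complex.mul_conj, Complex.normSq_eq_norm_sq, ← Complex.ofReal_mul]
    congr 1
    rcases eq_or_ne (‖f (r * ζ)‖) 0 with h | h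
    · rw [h, Real.zero_rpow (x := p) (by linarith)]; simp
    · have := (norm_nonneg (f (r * ζ))).lt_of_ne' h
      rw [← Real.rpow_natCast, ← Real.rpow_add this]
      congr 1; push_cast; ring
  have hgm : AEStronglyMeasurable g circleM := by
    have h1 := hcr.integrable_circleM.aestronglyMeasurable.aemeasurable
    refine AEMeasurable.aestronglyMeasurable ?_
    have h2 : Measurable (fun w : ℂ => (starRingEnd ℂ) w * ((‖w‖ ^ (p - 2) : ℝ) : ℂ)) := by
      fun_prop
    exact h2.comp_aemeasurable h1
  obtain ⟨B, hB⟩ := (isCompact_sphere (0 : ℂ) 1).exists_bound_of_continuousOn hcr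
  have hgb : ∀ᵐ ζ ∂circleM, ‖g ζ‖ ≤ B ^ (p - 1) := by
    filter_upwards [ae_circleM_mem_sphere] with ζ hζ
    rw [hgn]
    exact Real.rpow_le_rpow (norm_nonneg _) (hB ζ hζ) (by linarith)
  have hG := differentiableOn_integral_circleM hf hgm hgb
  set G : ℂ → ℂ := fun z => ∫ ζ, f (z * ζ) * g ζ ∂circleM
  have hGr : G r = (circleMean p f r : ℂ) := by
    simp only [G, circleMean, hfg, integral_complex_ofReal]
  have hMs := circleMean_nonneg p f s
  have hMr := circleMean_nonneg p f r
  have hbound : ∀ z ∈ sphere (0 : ℂ) s,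
      ‖G z‖ ≤ circleMean p f s ^ (1 / p) * circleMean p f r ^ (1 / q) := by
    intro z hz
    have hz' : ‖z‖ = s := by simpa using hz
    have hcz : ContinuousOn (fun ζ => f (z * ζ)) (sphere (0 : ℂ) 1) :=
      hf.continuousOn.comp (by fun_prop) fun ζ hζ => by
        simp only [mem_sphere_iff_norm, sub_zero] at hζ
        simp [hζ, hz', hs.2]
    have hz1 : ∫ ζ, ‖f (z * ζ)‖ ^ p ∂circleM = circleMean p f s := by
      have hu : ‖Complex.exp (arg z * Complex.I)‖ = 1 := Complex.norm_exp_ofReal_mul_I _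
      rw [circleMean, ← integral_circleM_rotate
        (continuousOn_norm_rpow_comp_mul (by linarith) hf.continuousOn hs) hu]
      congr 1
      ext ζ
      congr 3
      conv_lhs => rw [← Complex.norm_mul_exp_arg_mul_I z, hz']
      ring
    have hz2 : ∫ ζ, ‖g ζ‖ ^ q ∂circleM = circleMean p f r := by
      rw [circleMean]
      congr 1
      ext ζ
      rw [hgn, ← Real.rpow_mul (norm_nonneg _), hq, mul_div_cancel₀ _ (by linarith)]
    calc ‖G z‖ ≤ ∫ ζ, ‖f (z * ζ) * g ζ‖ ∂circleM := norm_integral_le_integral_norm _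
      _ = ∫ ζ, ‖f (z * ζ)‖ * ‖g ζ‖ ∂circleM := by simp only [norm_mul]
      _ ≤ _ := by
        rw [← hz1, ← hz2]
        exact integral_mul_norm_le_Lp_mul_Lq hpq (memLp_circleM hcz _)
          (MemLp.of_bound hgm _ hgb)
  rcases hs.1.eq_or_lt with h0 | h0
  · have : r = s := le_antisymm hrs (h0 ▸ hr.1)
    rw [this]
  have hmax : ‖G r‖ ≤ circleMean p f s ^ (1 / p) * circleMean p f r ^ (1 / q) := by
    refine Complex.norm_le_of_forall_mem_frontier_norm_le (U := ball (0 : ℂ) s) isBounded_ball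
      (hG.diffContOnCl_ball ?_) ?_ ?_
    · exact closedBall_subset_ball hs.2
    · rw [frontier_ball _ h0.ne']; exact hbound
    · rw [closure_ball _ h0.ne']
      simpa [abs_of_nonneg hr.1] using hrs
  rw [hGr, Complex.norm_real, Real.norm_of_nonneg hMr] at hmax
  rcases hMr.eq_or_lt with h0 | h0
  · rw [← h0]; exact hMs
  have hpos : 0 < circleMean p f r ^ (1 / q) := Real.rpow_pos_of_pos h0 _
  have h1 : circleMean p f r ^ (1 / p) ≤ circleMean p f s ^ (1 / p) := by
    refine le_of_mul_le_mul_right ?_ hpos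
    rw [← Real.rpow_add h0, one_div, one_div, hpq.inv_add_inv_eq_one, Real.rpow_one,
      ← one_div, ← one_div]
    exact hmax
  exact (Real.rpow_le_rpow_iff hMr hMs (by positivity)).1 h1

theorem circleMean_le_hardyNorm_rpow {p : ℝ} (hp : 1 < p) {f : ℂ → ℂ} (hf : MemHp p f) {r : ℝ}
    (hr : r ∈ Set.Ico (0 : ℝ) 1) : circleMean p f r ≤ hardyNorm p f ^ p := by
  have h0 := circleMean_nonneg p f r
  have h1 : circleMean p f r ^ (1 / p) ≤ hardyNorm p f := le_ciSup hf.2 (⟨r, hr⟩ : Set.Ico (0 : ℝ) 1)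
  calc circleMean p f r = (circleMean p f r ^ (1 / p)) ^ p := by
        rw [← Real.rpow_mul h0, one_div_mul_cancel (by linarith), Real.rpow_one]
    _ ≤ _ := Real.rpow_le_rpow (by positivity) h1 (by linarith)

theorem hardyNorm_nonneg (p : ℝ) (f : ℂ → ℂ) : 0 ≤ hardyNorm p f :=
  Real.iSup_nonneg fun r => Real.rpow_nonneg (circleMean_nonneg p f r) _

theorem hardyNorm_rpow_le {p : ℝ} (hp : 1 < p) {f : ℂ → ℂ} {A : ℝ}
    (hA : ∀ r ∈ Set.Ico (0 : ℝ) 1, circleMean p f r ≤ A) : hardyNorm p f ^ p ≤ A := by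
  have hA0 : 0 ≤ A := (circleMean_nonneg p f 0).trans (hA 0 (by simp))
  have : Nonempty (Set.Ico (0 : ℝ) 1) := ⟨⟨0, by simp⟩⟩
  have h1 : hardyNorm p f ≤ A ^ (1 / p) :=
    ciSup_le fun r => Real.rpow_le_rpow (circleMean_nonneg p f r) (hA r r.2) (by positivity)
  calc hardyNorm p f ^ p ≤ (A ^ (1 / p)) ^ p :=
        Real.rpow_le_rpow (hardyNorm_nonneg p f) h1 (by linarith)
    _ = A := by rw [← Real.rpow_mul hA0, one_div_mul_cancel (by linarith), Real.rpow_one]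

theorem memHp_of_circleMean_le {p : ℝ} (hp : 1 < p) {f : ℂ → ℂ}
    (hf : DifferentiableOn ℂ f (ball (0 : ℂ) 1)) {A : ℝ}
    (hA : ∀ r ∈ Set.Ico (0 : ℝ) 1, circleMean p f r ≤ A) : MemHp p f := by
  refine ⟨hf, A ^ (1 / p), ?_⟩
  rintro _ ⟨r, rfl⟩
  exact Real.rpow_le_rpow (circleMean_nonneg p f r) (hA r r.2) (by positivity)

theorem exists_lt_circleMean {p : ℝ} (hp : 1 < p) {f : ℂ → ℂ} {x : ℝ}
    (hx : x < hardyNorm p f ^ p) : ∃ r ∈ Set.Ico (0 : ℝ) 1, x < circleMean p f r := by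
  by_contra! hcon
  exact (hardyNorm_rpow_le hp hcon).not_gt hx

theorem one_sub_inv_mem_Ico (n : ℕ) : 1 - 1 / ((n : ℝ) + 1) ∈ Set.Ico (0 : ℝ) 1 := by
  have h1 : (0 : ℝ) < n + 1 := by positivity
  have h2 : 1 / ((n : ℝ) + 1) ≤ 1 := by
    rw [div_le_one h1]; linarith [(Nat.cast_nonneg n : (0 : ℝ) ≤ n)]
  have h3 : 0 < 1 / ((n : ℝ) + 1) := by positivity
  constructor <;> linarith

theorem tendsto_one_sub_inv :
    Filter.Tendsto (fun n : ℕ => 1 - 1 / ((n : ℝ) + 1)) Filter.atTop (nhds 1) := by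
  simpa using tendsto_one_div_add_atTop_nhds_zero_nat.const_sub (1 : ℝ)

theorem tendsto_circleMean {p : ℝ} (hp : 1 < p) {f : ℂ → ℂ} (hf : MemHp p f) :
    Filter.Tendsto (fun n : ℕ => circleMean p f (1 - 1 / ((n : ℝ) + 1))) Filter.atTop
      (nhds (hardyNorm p f ^ p)) := by
  refine tendsto_order.2 ⟨fun x hx => ?_, fun x hx => Filter.Eventually.of_forall fun n =>
    (circleMean_le_hardyNorm_rpow hp hf (one_sub_inv_mem_Ico n)).trans_lt hx⟩
  obtain ⟨r, hr, hxr⟩ := exists_lt_circleMean hp hx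
  filter_upwards [tendsto_one_sub_inv.eventually_const_lt hr.2] with n hn
  exact hxr.trans_le (circleMean_mono hp hf.1 hr (one_sub_inv_mem_Ico n) hn.le)

theorem lpNorm_circleM {p : ℝ} (hp : 1 < p) {f : ℂ → ℂ}
    (hf : ContinuousOn f (ball (0 : ℂ) 1)) {r : ℝ} (hr : r ∈ Set.Ico (0 : ℝ) 1) :
    lpNorm (fun ζ => f ((r : ℂ) * ζ)) (ENNReal.ofReal p) circleM = circleMean p f r ^ (1 / p) := by
  rw [lpNorm_eq_integral_norm_rpow_toReal (by simp; linarith) ENNReal.ofReal_ne_top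
    (continuousOn_comp_mul hf hr).integrable_circleM.aestronglyMeasurable,
    ENNReal.toReal_ofReal (by linarith), one_div, circleMean]

theorem hardyNorm_le_add_hardyNorm_sub {p : ℝ} (hp : 1 < p) {f g : ℂ → ℂ} (hf : MemHp p f)
    (hg : MemHp p g) (hfg : MemHp p (fun z => f z - g z)) :
    hardyNorm p f ≤ hardyNorm p g + hardyNorm p (fun z => f z - g z) := by
  have : Nonempty (Set.Ico (0 : ℝ) 1) := ⟨⟨0, by simp⟩⟩
  refine ciSup_le fun r => ?_
  have h1 : circleMean p g r ^ (1 / p) ≤ hardyNorm p g := le_ciSup hg.2 r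
  have h2 : circleMean p (fun z => f z - g z) r ^ (1 / p) ≤ hardyNorm p (fun z => f z - g z) :=
    le_ciSup hfg.2 r
  refine le_trans ?_ (add_le_add h1 h2)
  change circleMean p f r ^ (1 / p) ≤ _
  rw [← lpNorm_circleM hp hf.1.continuousOn r.2, ← lpNorm_circleM hp hg.1.continuousOn r.2,
    ← lpNorm_circleM hp hfg.1.continuousOn r.2]
  exact lpNorm_le_lpNorm_add_lpNorm_sub'
    (memLp_circleM (continuousOn_comp_mul hg.1.continuousOn r.2) _)
    (by simpa using hp.le)

theorem mapsTo_ofReal_mul_ball {s : ℝ} (hs : s ∈ Set.Ico (0 : ℝ) 1) :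
    Set.MapsTo (fun z : ℂ => (s : ℂ) * z) (ball (0 : ℂ) 1) (ball (0 : ℂ) 1) := by
  intro z hz
  simp only [mem_ball_zero_iff, norm_mul, Complex.norm_real, Real.norm_of_nonneg hs.1] at hz ⊢
  nlinarith [hs.1, hs.2, norm_nonneg z]

theorem differentiableOn_dilation {f : ℂ → ℂ} (hf : DifferentiableOn ℂ f (ball (0 : ℂ) 1)) {s : ℝ}
    (hs : s ∈ Set.Ico (0 : ℝ) 1) :
    DifferentiableOn ℂ (fun z => f ((s : ℂ) * z)) (ball (0 : ℂ) 1) :=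
  hf.comp (by fun_prop) (mapsTo_ofReal_mul_ball hs)

theorem circleMean_dilation (p : ℝ) (f : ℂ → ℂ) (s t : ℝ) :
    circleMean p (fun z => f ((s : ℂ) * z)) t = circleMean p f (s * t) := by
  simp only [circleMean, Complex.ofReal_mul, mul_assoc]

theorem memHp_dilation {p : ℝ} (hp : 1 < p) {f : ℂ → ℂ}
    (hf : DifferentiableOn ℂ f (ball (0 : ℂ) 1)) {s : ℝ} (hs : s ∈ Set.Ico (0 : ℝ) 1) :
    MemHp p (fun z => f ((s : ℂ) * z)) := by
  refine memHp_of_circleMean_le hp (differentiableOn_dilation hf hs) (A := circleMean p f s) ?_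
  intro t ht
  rw [circleMean_dilation]
  have h1 : s * t ≤ s := mul_le_of_le_one_right hs.1 ht.2.le
  exact circleMean_mono hp hf ⟨mul_nonneg hs.1 ht.1, h1.trans_lt hs.2⟩ hs h1

theorem one_sub_norm_le_norm_one_sub {l z : ℂ} (hz : ‖z‖ ≤ 1) :
    1 - ‖l‖ ≤ ‖1 - (starRingEnd ℂ) l * z‖ := by
  have h1 := norm_sub_norm_le (1 : ℂ) ((starRingEnd ℂ) l * z)
  rw [norm_one, norm_mul, RCLike.norm_conj] at h1
  nlinarith [norm_nonneg l]

theorem one_sub_conj_mul_ne_zero {l z : ℂ} (hl : ‖l‖ < 1) (hz : ‖z‖ ≤ 1) :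
    1 - (starRingEnd ℂ) l * z ≠ 0 := by
  have := one_sub_norm_le_norm_one_sub (l := l) hz
  rw [← norm_pos_iff]
  linarith

theorem memHp_kern {p : ℝ} (hp : 1 < p) {l : ℂ} (hl : ‖l‖ < 1) : MemHp p (kern l) := by
  refine memHp_of_circleMean_le hp (A := ((1 - ‖l‖)⁻¹) ^ p) ?_ ?_
  · intro z hz
    have hz' : ‖z‖ < 1 := by simpa using hz
    refine DifferentiableAt.differentiableWithinAt ?_
    unfold kern
    exact DifferentiableAt.inv (by fun_prop) (one_sub_conj_mul_ne_zero hl hz'.le)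
  · intro r hr
    have : circleMean p (kern l) r ≤ ∫ _, ((1 - ‖l‖)⁻¹) ^ p ∂circleM := by
      refine integral_mono_of_nonneg (Filter.Eventually.of_forall fun ζ => by positivity)
        (integrable_const _) ?_
      filter_upwards [ae_circleM_mem_sphere] with ζ hζ
      have h1 := mul_mem_ball_of_mem_sphere hr hζ
      rw [mem_ball_zero_iff] at h1
      have h2 := one_sub_norm_le_norm_one_sub (l := l) h1.le
      refine Real.rpow_le_rpow (norm_nonneg _) ?_ (by linarith)
      rw [kern, norm_inv]
      exact inv_anti₀ (by linarith) h2
    simpa using this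

theorem hardyNorm_kern_rotate {p : ℝ} (hp : 1 < p) {R : ℝ} (hR : R ∈ Set.Ico (0 : ℝ) 1) {u : ℂ}
    (hu : ‖u‖ = 1) : hardyNorm p (kern (R * u)) = hardyNorm p (kern R) := by
  have hR' : ‖(R : ℂ)‖ < 1 := by simpa [abs_of_nonneg hR.1] using hR.2
  unfold hardyNorm
  congr 1
  ext r
  congr 1
  rw [← integral_circleM_rotate (u := (starRingEnd ℂ) u) (g := fun ζ => ‖kern R (r * ζ)‖ ^ p)
    (continuousOn_norm_rpow_comp_mul (by linarith) (memHp_kern hp hR').1.continuousOn r.2)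
    (by simpa using hu)]
  congr 1
  ext ζ
  congr 2
  simp only [kern, map_mul, Complex.conj_ofReal]
  ring

theorem integral_norm_kern_rpow_le {p : ℝ} (hp : 1 < p) {R : ℝ} (hR : R ∈ Set.Ico (0 : ℝ) 1)
    {z : ℂ} (hz : z ∈ ball (0 : ℂ) 1) :
    ∫ ζ, ‖kern (R * ζ) z‖ ^ p ∂circleM ≤ hardyNorm p (kern R) ^ p := by
  have hR' : ‖(R : ℂ)‖ < 1 := by simpa [abs_of_nonneg hR.1] using hR.2
  have hz' : ‖z‖ ∈ Set.Ico (0 : ℝ) 1 := ⟨norm_nonneg z, by simpa using hz⟩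
  refine le_trans (le_of_eq ?_) (circleMean_le_hardyNorm_rpow hp (memHp_kern hp hR') hz')
  have hu : ‖Complex.exp (arg ((starRingEnd ℂ) z) * Complex.I)‖ = 1 :=
    Complex.norm_exp_ofReal_mul_I _
  rw [circleMean, ← integral_circleM_rotate (continuousOn_norm_rpow_comp_mul (by linarith)
    (memHp_kern hp hR').1.continuousOn hz') hu]
  congr 1
  ext ζ
  congr 1
  have h1 : (‖z‖ : ℂ) * (Complex.exp (arg ((starRingEnd ℂ) z) * Complex.I) * ζ)
      = (starRingEnd ℂ) z * ζ := by
    conv_rhs => rw [← Complex.norm_mul_exp_arg_mul_I ((starRingEnd ℂ) z), RCLike.norm_conj]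
    ring
  rw [h1, kern, kern, norm_inv, norm_inv, ← RCLike.norm_conj]
  congr 2
  simp only [map_sub, map_mul, map_one, Complex.conj_ofReal, Complex.conj_conj]
  ring

theorem circleMean_kern_ge {p : ℝ} (hp : 1 < p) {R : ℝ} (hR : R ∈ Set.Ico (0 : ℝ) 1) :
    (2 * Real.pi)⁻¹ * (3 ^ (-p) * (1 - R) ^ (1 - p)) ≤ circleMean p (kern R) R := by
  have hR' : ‖(R : ℂ)‖ < 1 := by simpa [abs_of_nonneg hR.1] using hR.2
  have hc := continuousOn_norm_rpow_comp_mul (p := p) (by linarith)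
    (memHp_kern hp hR').1.continuousOn hR
  have hη : 0 < 1 - R := by linarith [hR.2]
  have hcont : Continuous fun θ : ℝ => ‖kern R (R * circleMap 0 1 θ)‖ ^ p :=
    hc.comp_continuous (by fun_prop) fun θ => by simp
  rw [circleMean, integral_circleM_eq_circleAverage hc, Real.circleAverage_def, smul_eq_mul]
  refine mul_le_mul_of_nonneg_left ?_ (by positivity)
  have hπ := Real.pi_gt_three
  calc 3 ^ (-p) * (1 - R) ^ (1 - p) = ∫ _ in (0 : ℝ)..(1 - R), (3 * (1 - R)) ^ (-p) := by
        rw [intervalIntegral.integral_const, sub_zero, smul_eq_mul,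
          Real.mul_rpow (by norm_num) hη.le, sub_eq_add_neg 1 p, Real.rpow_add hη, Real.rpow_one]
        ring
    _ ≤ ∫ θ in (0 : ℝ)..(1 - R), ‖kern R (R * circleMap 0 1 θ)‖ ^ p := by
        refine intervalIntegral.integral_mono_on hη.le (by simp)
          (hcont.intervalIntegrable _ _) fun θ hθ => ?_
        rw [Real.rpow_neg (by positivity), ← Real.inv_rpow (by positivity)]
        refine Real.rpow_le_rpow (by positivity) ?_ (by linarith)
        rw [kern, norm_inv]
        have hexp : ‖1 - Complex.exp (θ * Complex.I)‖ ≤ θ := by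
          have := Real.norm_exp_I_mul_ofReal_sub_one_le (x := θ)
          rwa [norm_sub_rev, mul_comm Complex.I, Real.norm_of_nonneg hθ.1] at this
        have hmem : ‖(R : ℂ) * circleMap 0 1 θ‖ ≤ 1 := by simpa [abs_of_nonneg hR.1] using hR.2.le
        refine inv_anti₀ (norm_pos_iff.2 (one_sub_conj_mul_ne_zero hR' hmem)) ?_
        have h1 : 1 - (starRingEnd ℂ) (R : ℂ) * (R * circleMap 0 1 θ)
            = ((1 - R ^ 2 : ℝ) : ℂ) + ((R ^ 2 : ℝ) : ℂ) * (1 - Complex.exp (θ * Complex.I)) := by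
          simp [circleMap]; ring
        have hR1 := hR.1
        have hR2 : 0 ≤ 1 - R ^ 2 := by nlinarith
        rw [h1]
        refine (norm_add_le _ _).trans ?_
        rw [norm_mul, Complex.norm_real, Complex.norm_real, Real.norm_of_nonneg hR2,
          Real.norm_of_nonneg (sq_nonneg R)]
        have h2 : R ^ 2 * ‖1 - Complex.exp (θ * Complex.I)‖ ≤ 1 * θ := by
          gcongr
          nlinarith
        nlinarith [hθ.2]
    _ ≤ _ := by
        refine intervalIntegral.integral_mono_interval le_rfl hη.le (by linarith [hR.1]) ?_
          (hcont.intervalIntegrable _ _)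
        exact Filter.Eventually.of_forall fun θ => by simp only [Pi.zero_apply]; positivity

theorem exists_hardyNorm_kern_ge {p : ℝ} (hp : 1 < p) {δ : ℝ} (hδ : 0 < δ) (A : ℝ) :
    ∃ R ∈ Set.Ico (0 : ℝ) 1, 1 - R ≤ δ ∧ A ≤ hardyNorm p (kern R) ^ p := by
  have h1 : Filter.Tendsto (fun η : ℝ => (2 * Real.pi)⁻¹ * (3 ^ (-p) * η ^ (1 - p)))
      (nhdsWithin 0 (Set.Ioi 0)) Filter.atTop :=
    ((tendsto_rpow_neg_nhdsGT_zero (by linarith)).const_mul_atTop (by positivity)).const_mul_atTop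
      (by positivity)
  have hm : Set.Ioo (0 : ℝ) (min δ 1) ∈ nhdsWithin (0 : ℝ) (Set.Ioi 0) :=
    Ioo_mem_nhdsGT (by positivity)
  obtain ⟨η, hA, hη⟩ := ((h1.eventually_ge_atTop A).and hm).exists
  have h2 := hη.2.trans_le (min_le_left _ _)
  have h3 := hη.2.trans_le (min_le_right _ _)
  have hR : 1 - η ∈ Set.Ico (0 : ℝ) 1 := ⟨by linarith, by linarith [hη.1]⟩
  have hR' : ‖((1 - η : ℝ) : ℂ)‖ < 1 := by
    rw [Complex.norm_real, Real.norm_of_nonneg hR.1]; exact hR.2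
  refine ⟨1 - η, hR, by linarith, ?_⟩
  refine le_trans ?_ (circleMean_le_hardyNorm_rpow hp (memHp_kern hp hR') hR)
  refine le_trans ?_ (circleMean_kern_ge hp hR)
  simpa using hA

theorem continuousOn_kern {R : ℝ} (hR : R ∈ Set.Ico (0 : ℝ) 1) :
    ContinuousOn (fun x : ℂ × ℂ => kern (R * x.1) x.2)
      (sphere (0 : ℂ) 1 ×ˢ ball (0 : ℂ) 1) := by
  unfold kern
  refine ContinuousOn.inv₀ (by fun_prop) ?_
  rintro ⟨ζ, z⟩ ⟨hζ, hz⟩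
  have h1 := mul_mem_ball_of_mem_sphere hR hζ
  rw [mem_ball_zero_iff] at h1 hz
  exact one_sub_conj_mul_ne_zero h1 hz.le

theorem norm_one_sub_conj_mul_ge {R : ℝ} (hR : R ∈ Set.Ico (0 : ℝ) 1) {ζ z : ℂ}
    (hζ : ζ ∈ sphere (0 : ℂ) 1) (hz : z ∈ ball (0 : ℂ) 1) :
    dist ζ z - (1 - R) ≤ ‖1 - (starRingEnd ℂ) (R * ζ) * z‖ := by
  rw [mem_ball_zero_iff] at hz
  simp only [mem_sphere_iff_norm, sub_zero] at hζ
  have h1 : ζ * (1 - (starRingEnd ℂ) (R * ζ) * z) = (ζ - z) + ((1 - R : ℝ) : ℂ) * z := by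
    have h2 : ζ * (starRingEnd ℂ) ζ = 1 := by
      rw [Complex.mul_conj, Complex.normSq_eq_norm_sq, hζ]; simp
    rw [map_mul, Complex.conj_ofReal]
    push_cast
    linear_combination (-(R : ℂ) * z) * h2
  have h3 : ‖1 - (starRingEnd ℂ) (R * ζ) * z‖ = ‖(ζ - z) + ((1 - R : ℝ) : ℂ) * z‖ := by
    rw [← h1, norm_mul, hζ, one_mul]
  have h4 := norm_sub_le_norm_add (ζ - z) (((1 - R : ℝ) : ℂ) * z)
  have h5 : 0 ≤ 1 - R := by linarith [hR.2]
  rw [norm_mul, Complex.norm_real, Real.norm_of_nonneg h5] at h4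
  rw [h3, dist_eq_norm]
  nlinarith [norm_nonneg z]

/-- The normalized kernels `‖k_{Rζ}(z)‖ ^ p / ‖k_R‖ ^ p` are asymptotically dominated, uniformly on
the disc, by an approximate identity. -/
theorem exists_integral_mul_kern_le {p : ℝ} (hp : 1 < p) {φ : ℂ → ℝ}
    (hφ : ContinuousOn φ (closedBall (0 : ℂ) 1)) (hφ0 : ∀ z, 0 ≤ φ z) {ε : ℝ} (hε : 0 < ε) :
    ∃ R ∈ Set.Ico (0 : ℝ) 1, 0 < hardyNorm p (kern R) ^ p ∧ ∀ z ∈ ball (0 : ℂ) 1,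
      ∫ ζ, φ ζ * ‖kern (R * ζ) z‖ ^ p ∂circleM ≤ hardyNorm p (kern R) ^ p * (φ z + ε) := by
  obtain ⟨B, hB⟩ := (isCompact_closedBall (0 : ℂ) 1).exists_bound_of_continuousOn hφ
  have hB' : ∀ ζ ∈ sphere (0 : ℂ) 1, φ ζ ≤ B := fun ζ hζ =>
    (Real.le_norm_self _).trans (hB ζ (sphere_subset_closedBall hζ))
  have hB0 : 0 ≤ B := (norm_nonneg _).trans (hB 0 (by simp))
  obtain ⟨δ, hδ, hφδ⟩ := Metric.uniformContinuousOn_iff.1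
    ((isCompact_closedBall (0 : ℂ) 1).uniformContinuousOn_of_continuous hφ) (ε / 2) (by positivity)
  obtain ⟨R, hR, hRδ, hRA⟩ := exists_hardyNorm_kern_ge hp (half_pos hδ)
    (B * (2 / δ) ^ p / (ε / 2) + 1)
  set D := hardyNorm p (kern R) ^ p with hD
  have hA0 : 0 ≤ B * (2 / δ) ^ p / (ε / 2) := by positivity
  have hBD : B * (2 / δ) ^ p ≤ D * (ε / 2) := by
    rw [← div_le_iff₀ (by positivity)]; linarith
  refine ⟨R, hR, by linarith, fun z hz => ?_⟩
  have hkc : ContinuousOn (fun ζ => ‖kern (R * ζ) z‖ ^ p) (sphere (0 : ℂ) 1) := by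
    refine ContinuousOn.rpow_const ?_ fun _ _ => Or.inr (by linarith)
    exact ((continuousOn_kern hR).comp (f := fun ζ => (ζ, z)) (by fun_prop)
      fun ζ hζ => ⟨hζ, hz⟩).norm
  have hki := hkc.integrable_circleM
  calc ∫ ζ, φ ζ * ‖kern (R * ζ) z‖ ^ p ∂circleM
      ≤ ∫ ζ, ((φ z + ε / 2) * ‖kern (R * ζ) z‖ ^ p + B * (2 / δ) ^ p) ∂circleM := by
        refine integral_mono_ae
          ((hφ.mono sphere_subset_closedBall).mul hkc).integrable_circleM
          ((hki.const_mul _).add (integrable_const _)) ?_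
        filter_upwards [ae_circleM_mem_sphere] with ζ hζ
        have hk0 : 0 ≤ ‖kern (R * ζ) z‖ ^ p := by positivity
        rcases lt_or_ge (dist ζ z) δ with h | h
        · have h1 := hφδ ζ (sphere_subset_closedBall hζ) z (ball_subset_closedBall hz) h
          rw [Real.dist_eq] at h1
          have h2 : φ ζ ≤ φ z + ε / 2 := by linarith [(abs_lt.1 h1).2]
          have h3 : 0 ≤ B * (2 / δ) ^ p := by positivity
          have := mul_le_mul_of_nonneg_right h2 hk0
          linarith
        · have h1 := norm_one_sub_conj_mul_ge hR hζ hz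
          have h2 : ‖kern (R * ζ) z‖ ≤ 2 / δ := by
            rw [kern, norm_inv, ← inv_div]
            exact inv_anti₀ (by positivity) (by linarith)
          have h3 : φ ζ * ‖kern (R * ζ) z‖ ^ p ≤ B * (2 / δ) ^ p :=
            mul_le_mul (hB' ζ hζ) (Real.rpow_le_rpow (norm_nonneg _) h2 (by linarith)) hk0 hB0
          have h4 : 0 ≤ (φ z + ε / 2) * ‖kern (R * ζ) z‖ ^ p :=
            mul_nonneg (by linarith [hφ0 z]) hk0
          linarith
    _ = (φ z + ε / 2) * ∫ ζ, ‖kern (R * ζ) z‖ ^ p ∂circleM + B * (2 / δ) ^ p := by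
        rw [integral_add (hki.const_mul _) (integrable_const _), integral_const_mul]
        simp
    _ ≤ (φ z + ε / 2) * D + D * (ε / 2) :=
        add_le_add (mul_le_mul_of_nonneg_left (integral_norm_kern_rpow_le hp hR hz)
          (by linarith [hφ0 z])) hBD
    _ = D * (φ z + ε) := by ring

/-- Testing on reproducing kernels gives the lower bound for all dilations. -/
theorem circleMean_le_of_kern_bound {p : ℝ} (hp : 1 < p) {h ψ : ℂ → ℂ} (hh : MemHp p h)
    (hψd : DifferentiableOn ℂ ψ (ball (0 : ℂ) 1))
    (hψm : Set.MapsTo ψ (ball (0 : ℂ) 1) (ball (0 : ℂ) 1))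
    (hW : ∀ f : ℂ → ℂ, MemHp p f → MemHp p (fun z => h z * f (ψ z))) {C : ℝ} (hC0 : 0 ≤ C)
    (hC : ∀ l ∈ ball (0 : ℂ) 1,
      C * hardyNorm p (kern l) ≤ hardyNorm p (fun z => h z * kern l (ψ z)))
    {f : ℂ → ℂ} (hf : DifferentiableOn ℂ f (ball (0 : ℂ) 1)) {s : ℝ}
    (hs : s ∈ Set.Ico (0 : ℝ) 1) :
    C ^ p * circleMean p f s ≤ hardyNorm p (fun z => h z * f (s * ψ z)) ^ p := by
  have hp0 : 0 ≤ p := by linarith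
  set φ : ℂ → ℝ := fun z => ‖f (s * z)‖ ^ p with hφdef
  have hφ0 : ∀ z, 0 ≤ φ z := fun z => by positivity
  have hφ : ContinuousOn φ (closedBall (0 : ℂ) 1) := by
    refine ContinuousOn.rpow_const (hf.continuousOn.comp (by fun_prop) ?_).norm
      fun _ _ => Or.inr hp0
    intro z hz
    simp only [mem_closedBall_zero_iff] at hz
    simp only [mem_ball_zero_iff, norm_mul, Complex.norm_real, Real.norm_of_nonneg hs.1]
    nlinarith [hs.1, hs.2, norm_nonneg z]
  have hφS := hφ.mono sphere_subset_closedBall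
  have hfs := memHp_dilation hp hf hs
  have hWf := hW _ hfs
  set Wf : ℂ → ℂ := fun z => h z * f (s * ψ z) with hWfdef
  have key : ∀ ε > 0, C ^ p * circleMean p f s ≤ hardyNorm p Wf ^ p + ε * hardyNorm p h ^ p := by
    intro ε hε
    obtain ⟨R, hR, hD0, hk⟩ := exists_integral_mul_kern_le hp hφ hφ0 hε
    set D := hardyNorm p (kern R) ^ p with hDdef
    set Wk : ℂ → ℂ → ℂ := fun ζ z => h z * kern (R * ζ) (ψ z) with hWk
    have hWkmem : ∀ ζ ∈ sphere (0 : ℂ) 1, MemHp p (Wk ζ) := fun ζ hζ =>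
      hW _ (memHp_kern hp (by simpa using mul_mem_ball_of_mem_sphere hR hζ))
    have hWkge : ∀ ζ ∈ sphere (0 : ℂ) 1, C ^ p * D ≤ hardyNorm p (Wk ζ) ^ p := by
      intro ζ hζ
      have h1 := hC _ (mul_mem_ball_of_mem_sphere hR hζ)
      rw [hardyNorm_kern_rotate hp hR (by simpa using hζ)] at h1
      rw [hDdef, ← Real.mul_rpow hC0 (hardyNorm_nonneg _ _)]
      exact Real.rpow_le_rpow (mul_nonneg hC0 (hardyNorm_nonneg _ _)) h1 hp0
    have hcont : ∀ r ∈ Set.Ico (0 : ℝ) 1, ContinuousOn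
        (fun x : ℂ × ℂ => φ x.1 * ‖Wk x.1 (r * x.2)‖ ^ p)
        (sphere (0 : ℂ) 1 ×ˢ sphere (0 : ℂ) 1) := by
      intro r hr
      have hfst : Set.MapsTo (Prod.fst : ℂ × ℂ → ℂ) (sphere (0 : ℂ) 1 ×ˢ sphere (0 : ℂ) 1)
        (sphere (0 : ℂ) 1) := fun x hx => hx.1
      have hsnd : Set.MapsTo (Prod.snd : ℂ × ℂ → ℂ) (sphere (0 : ℂ) 1 ×ˢ sphere (0 : ℂ) 1)
        (sphere (0 : ℂ) 1) := fun x hx => hx.2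
      refine (hφS.comp continuousOn_fst hfst).mul (ContinuousOn.rpow_const
        (ContinuousOn.norm (ContinuousOn.mul ?_ ?_)) fun _ _ => Or.inr hp0)
      · exact (continuousOn_comp_mul hh.1.continuousOn hr).comp continuousOn_snd hsnd
      · exact (continuousOn_kern hR).comp (f := fun x : ℂ × ℂ => (x.1, ψ (r * x.2)))
          (continuousOn_fst.prodMk
            ((continuousOn_comp_mul hψd.continuousOn hr).comp continuousOn_snd hsnd))
          fun x hx => ⟨hx.1, hψm (mul_mem_ball_of_mem_sphere hr hx.2)⟩
    have hupper : ∀ r ∈ Set.Ico (0 : ℝ) 1,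
        Integrable (fun ζ => φ ζ * circleMean p (Wk ζ) r) circleM ∧
        ∫ ζ, φ ζ * circleMean p (Wk ζ) r ∂circleM ≤
          D * (hardyNorm p Wf ^ p + ε * hardyNorm p h ^ p) := by
      intro r hr
      obtain ⟨hint, hswap⟩ := integral_circleM_prod_swap
        (g := fun ζ η => φ ζ * ‖Wk ζ (r * η)‖ ^ p) (hcont r hr)
      simp only [integral_const_mul] at hint hswap
      refine ⟨hint, ?_⟩
      have hc1 := continuousOn_norm_rpow_comp_mul hp0 hWf.1.continuousOn hr
      have hc2 := continuousOn_norm_rpow_comp_mul hp0 hh.1.continuousOn hr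
      have hi1 := hc1.integrable_circleM
      have hi2 := hc2.integrable_circleM
      change ∫ ζ, φ ζ * ∫ η, ‖Wk ζ (r * η)‖ ^ p ∂circleM ∂circleM ≤ _
      rw [hswap]
      calc ∫ η, ∫ ζ, φ ζ * ‖Wk ζ (r * η)‖ ^ p ∂circleM ∂circleM
          ≤ ∫ η, D * (‖Wf (r * η)‖ ^ p + ε * ‖h (r * η)‖ ^ p) ∂circleM := by
            refine integral_mono_of_nonneg (Filter.Eventually.of_forall fun η =>
              integral_nonneg fun ζ => mul_nonneg (hφ0 ζ) (by positivity))
              ((hi1.add (hi2.const_mul ε)).const_mul D) ?_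
            filter_upwards [ae_circleM_mem_sphere] with η hη
            have h1 : ∀ ζ, φ ζ * ‖Wk ζ (r * η)‖ ^ p =
                ‖h (r * η)‖ ^ p * (φ ζ * ‖kern (R * ζ) (ψ (r * η))‖ ^ p) := fun ζ => by
              rw [hWk, norm_mul, Real.mul_rpow (norm_nonneg _) (norm_nonneg _)]; ring
            have h2 : ‖Wf (r * η)‖ ^ p = ‖h (r * η)‖ ^ p * φ (ψ (r * η)) := by
              rw [hWfdef, norm_mul, Real.mul_rpow (norm_nonneg _) (norm_nonneg _)]
            simp only [h1, h2, integral_const_mul]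
            have h3 := mul_le_mul_of_nonneg_left
              (hk _ (hψm (mul_mem_ball_of_mem_sphere hr hη)))
              (show 0 ≤ ‖h (r * η)‖ ^ p by positivity)
            refine h3.trans (le_of_eq ?_)
            ring
        _ = D * (circleMean p Wf r + ε * circleMean p h r) := by
            rw [integral_const_mul, integral_add hi1 (hi2.const_mul ε), integral_const_mul]
            rfl
        _ ≤ _ := by
            gcongr
            · exact circleMean_le_hardyNorm_rpow hp hWf hr
            · exact circleMean_le_hardyNorm_rpow hp hh hr
    have hlim : Filter.Tendsto (fun n : ℕ => ∫ ζ, min (φ ζ * circleMean p (Wk ζ)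
        (1 - 1 / ((n : ℝ) + 1))) (φ ζ * (C ^ p * D)) ∂circleM) Filter.atTop
        (nhds (∫ ζ, φ ζ * (C ^ p * D) ∂circleM)) := by
      have hφi : Integrable (fun ζ => φ ζ * (C ^ p * D)) circleM :=
        hφS.integrable_circleM.mul_const _
      refine tendsto_integral_of_dominated_convergence (fun ζ => φ ζ * (C ^ p * D))
        (fun n => ((hupper _ (one_sub_inv_mem_Ico n)).1.inf hφi).aestronglyMeasurable) hφi
        (fun n => Filter.Eventually.of_forall fun ζ => ?_) ?_
      · rw [Real.norm_of_nonneg]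
        · exact min_le_right _ _
        · exact le_min (mul_nonneg (hφ0 ζ) (circleMean_nonneg _ _ _))
            (mul_nonneg (hφ0 ζ) (by positivity))
      · filter_upwards [ae_circleM_mem_sphere] with ζ hζ
        have h1 := ((tendsto_circleMean hp (hWkmem ζ hζ)).const_mul (φ ζ)).min
          (tendsto_const_nhds (x := φ ζ * (C ^ p * D)))
        rwa [min_eq_right (mul_le_mul_of_nonneg_left (hWkge ζ hζ) (hφ0 ζ))] at h1
    have hle : ∫ ζ, φ ζ * (C ^ p * D) ∂circleM ≤
        D * (hardyNorm p Wf ^ p + ε * hardyNorm p h ^ p) := by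
      refine le_of_tendsto hlim (Filter.Eventually.of_forall fun n => ?_)
      obtain ⟨h1, h2⟩ := hupper _ (one_sub_inv_mem_Ico n)
      exact (integral_mono (h1.inf (hφS.integrable_circleM.mul_const _)) h1
        fun ζ => min_le_left _ _).trans h2
    rw [integral_mul_const] at hle
    refine le_of_mul_le_mul_left (le_trans (le_of_eq ?_) hle) hD0
    rw [circleMean]
    ring
  refine le_of_forall_pos_le_add fun ε hε => ?_
  have hH : 0 ≤ hardyNorm p h ^ p := Real.rpow_nonneg (hardyNorm_nonneg _ _) _
  refine (key (ε / (hardyNorm p h ^ p + 1)) (by positivity)).trans ?_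
  gcongr
  rw [div_mul_eq_mul_div, div_le_iff₀ (by positivity)]
  nlinarith

theorem norm_midpoint_rpow_lt {p : ℝ} (hp : 1 < p) {a b : ℂ} (hab : a ≠ b) :
    ‖(a + b) / 2‖ ^ p < (‖a‖ ^ p + ‖b‖ ^ p) / 2 := by
  have h2 : ‖(a + b) / 2‖ = ‖a + b‖ / 2 := by simp
  rcases eq_or_ne ‖a‖ ‖b‖ with h | h
  · have h3 : ‖(a + b) / 2‖ < ‖b‖ := by
      have h4 := parallelogram_law_with_norm ℝ a b
      have h5 : 0 < ‖a - b‖ := norm_pos_iff.2 (sub_ne_zero.2 hab)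
      rw [h2]
      rw [h] at h4
      nlinarith [norm_nonneg (a + b), norm_nonneg b]
    have := Real.rpow_lt_rpow (norm_nonneg _) h3 (by linarith : 0 < p)
    rw [h]; linarith
  · have h3 := (strictConvexOn_rpow hp).2 (Set.mem_Ici.2 (norm_nonneg a))
      (Set.mem_Ici.2 (norm_nonneg b)) h (by norm_num : (0 : ℝ) < 1 / 2)
      (by norm_num : (0 : ℝ) < 1 / 2) (by norm_num)
    simp only [smul_eq_mul] at h3
    have h4 : ‖(a + b) / 2‖ ^ p ≤ (1 / 2 * ‖a‖ + 1 / 2 * ‖b‖) ^ p := by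
      refine Real.rpow_le_rpow (norm_nonneg _) ?_ (by linarith)
      rw [h2]; linarith [norm_add_le a b]
    linarith

/-- A pointwise form of the uniform convexity of `L^p`. -/
theorem exists_norm_sub_rpow_le {p : ℝ} (hp : 1 < p) {ε : ℝ} (hε : 0 < ε) :
    ∃ K > 0, ∀ a b : ℂ, ‖a - b‖ ^ p ≤ ε * (‖a‖ ^ p + ‖b‖ ^ p) +
      K * ((‖a‖ ^ p + ‖b‖ ^ p) / 2 - ‖(a + b) / 2‖ ^ p) := by
  have hp0 : 0 < p := by linarith
  have hcd : Continuous fun x : ℂ × ℂ => ‖x.1 - x.2‖ ^ p :=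
    Continuous.rpow_const (by fun_prop) fun _ => Or.inr hp0.le
  have hcg : Continuous fun x : ℂ × ℂ =>
      (‖x.1‖ ^ p + ‖x.2‖ ^ p) / 2 - ‖(x.1 + x.2) / 2‖ ^ p := by
    refine Continuous.sub (Continuous.div_const (Continuous.add ?_ ?_) _) ?_ <;>
    exact Continuous.rpow_const (by fun_prop) fun _ => Or.inr hp0.le
  have hT : IsCompact (sphere (0 : ℂ × ℂ) 1 ∩ {x | ε ≤ ‖x.1 - x.2‖ ^ p}) :=
    (isCompact_sphere 0 1).inter_right (isClosed_le continuous_const hcd)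
  obtain ⟨g₀, hg₀, hg⟩ := hT.exists_forall_le' hcg.continuousOn (a := 0) (by
    rintro ⟨a, b⟩ ⟨-, hx⟩
    simp only [Set.mem_ofPred_eq] at hx
    have hab : a ≠ b := by
      rintro rfl
      rw [sub_self, norm_zero, Real.zero_rpow hp0.ne'] at hx
      linarith
    have := norm_midpoint_rpow_lt hp hab
    simp only
    linarith)
  have hmid : ∀ a b : ℂ, 0 ≤ (‖a‖ ^ p + ‖b‖ ^ p) / 2 - ‖(a + b) / 2‖ ^ p := by
    intro a b
    rcases eq_or_ne a b with rfl | h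
    · simp
    · linarith [norm_midpoint_rpow_lt hp h]
  have hK : 0 < 2 ^ p / g₀ := by positivity
  have hsph : ∀ a b : ℂ, (a, b) ∈ sphere (0 : ℂ × ℂ) 1 → ‖a - b‖ ^ p ≤
      ε * (‖a‖ ^ p + ‖b‖ ^ p) +
      2 ^ p / g₀ * ((‖a‖ ^ p + ‖b‖ ^ p) / 2 - ‖(a + b) / 2‖ ^ p) := by
    intro a b hab
    have hmax : max ‖a‖ ‖b‖ = 1 := by simpa [Prod.norm_def] using hab
    have ha : ‖a‖ ≤ 1 := hmax ▸ le_max_left _ _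
    have hb : ‖b‖ ≤ 1 := hmax ▸ le_max_right _ _
    have ha0 : 0 ≤ ‖a‖ ^ p := by positivity
    have hb0 : 0 ≤ ‖b‖ ^ p := by positivity
    rcases lt_or_ge (‖a - b‖ ^ p) ε with h | h
    · have h1 : 1 ≤ ‖a‖ ^ p + ‖b‖ ^ p := by
        rcases max_choice ‖a‖ ‖b‖ with h' | h' <;> rw [hmax] at h' <;> rw [← h', Real.one_rpow] <;>
          linarith
      have h2 := mul_nonneg hK.le (hmid a b)
      nlinarith
    · have h1 : g₀ ≤ (‖a‖ ^ p + ‖b‖ ^ p) / 2 - ‖(a + b) / 2‖ ^ p := hg (a, b) ⟨hab, h⟩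
      have h2 : ‖a - b‖ ^ p ≤ 2 ^ p :=
        Real.rpow_le_rpow (norm_nonneg _) (by linarith [norm_sub_le a b]) hp0.le
      have h3 : 2 ^ p / g₀ * g₀ = 2 ^ p := div_mul_cancel₀ _ hg₀.ne'
      have h4 := mul_le_mul_of_nonneg_left h1 hK.le
      have h5 : 0 ≤ ε * (‖a‖ ^ p + ‖b‖ ^ p) := by positivity
      linarith
  refine ⟨2 ^ p / g₀, hK, fun a b => ?_⟩
  rcases eq_or_ne (a, b) 0 with h0 | h0
  · obtain ⟨rfl, rfl⟩ := Prod.mk_eq_zero.1 h0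
    simp [Real.zero_rpow hp0.ne']
  set c := ‖(a, b)‖ with hc
  have hc0 : 0 < c := norm_pos_iff.2 h0
  have hcp : 0 < c ^ p := by positivity
  have hcC : (c : ℂ) ≠ 0 := by exact_mod_cast hc0.ne'
  have h1 := hsph (a / c) (b / c) (by
    have : ((a / c, b / c) : ℂ × ℂ) = (c : ℂ)⁻¹ • (a, b) := by
      simp [div_eq_inv_mul]
    rw [this, mem_sphere_zero_iff_norm, norm_smul, norm_inv, Complex.norm_real, ← hc,
      Real.norm_of_nonneg hc0.le, inv_mul_cancel₀ hc0.ne'])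
  have hdiv : ∀ x : ℂ, ‖x / c‖ ^ p = ‖x‖ ^ p / c ^ p := fun x => by
    rw [norm_div, Complex.norm_real, Real.norm_of_nonneg hc0.le,
      Real.div_rpow (norm_nonneg _) hc0.le]
  rw [← sub_div, ← add_div, div_right_comm, hdiv, hdiv, hdiv, hdiv] at h1
  have h2 := mul_le_mul_of_nonneg_right h1 hcp.le
  rw [div_mul_cancel₀ _ hcp.ne'] at h2
  refine h2.trans (le_of_eq ?_)
  field_simp

/-- Dilations of `f ∈ H^p` converge to `f` in `H^p`. -/
theorem eventually_hardyNorm_dilation_sub_le {p : ℝ} (hp : 1 < p) {f : ℂ → ℂ} (hf : MemHp p f)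
    {ε : ℝ} (hε : 0 < ε) : ∀ᶠ n : ℕ in Filter.atTop,
      MemHp p (fun z => f (((1 - 1 / ((n : ℝ) + 1) : ℝ) : ℂ) * z) - f z) ∧
      hardyNorm p (fun z => f (((1 - 1 / ((n : ℝ) + 1) : ℝ) : ℂ) * z) - f z) ^ p ≤ ε := by
  have hp0 : 0 ≤ p := by linarith
  set A := hardyNorm p f ^ p with hA
  have hA0 : 0 ≤ A := Real.rpow_nonneg (hardyNorm_nonneg _ _) _
  obtain ⟨K, hK, hconv⟩ := exists_norm_sub_rpow_le hp
    (show 0 < ε / (4 * (A + 1)) by positivity)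
  obtain ⟨t₀, ht₀, hAt⟩ := exists_lt_circleMean hp
    (show A - ε / (2 * K) < hardyNorm p f ^ p by
      have : 0 < ε / (2 * K) := by positivity
      linarith)
  set s : ℕ → ℝ := fun n => 1 - 1 / ((n : ℝ) + 1) with hsdef
  have hs : ∀ n, s n ∈ Set.Ico (0 : ℝ) 1 := one_sub_inv_mem_Ico
  set g : ℕ → ℂ → ℂ := fun n z => (f (s n * z) + f z) / 2 with hg
  have hfd := fun n => differentiableOn_dilation hf.1 (hs n)
  have hgd : ∀ n, DifferentiableOn ℂ (g n) (ball (0 : ℂ) 1) := fun n =>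
    ((hfd n).add hf.1).div_const 2
  have hdd : ∀ n, DifferentiableOn ℂ (fun z => f (s n * z) - f z) (ball (0 : ℂ) 1) := fun n =>
    (hfd n).sub hf.1
  have hlim : Filter.Tendsto (fun n => circleMean p (g n) t₀) Filter.atTop
      (nhds (circleMean p f t₀)) := by
    obtain ⟨B, hB⟩ := (isCompact_closedBall (0 : ℂ) t₀).exists_bound_of_continuousOn
      (hf.1.continuousOn.mono (closedBall_subset_ball ht₀.2))
    refine tendsto_integral_of_dominated_convergence (fun _ => B ^ p)
      (fun n => (continuousOn_norm_rpow_comp_mul hp0 (hgd n).continuousOn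
        ht₀).integrable_circleM.aestronglyMeasurable) (integrable_const _) (fun n => ?_) ?_
    · filter_upwards [ae_circleM_mem_sphere] with ζ hζ
      simp only [mem_sphere_iff_norm, sub_zero] at hζ
      rw [Real.norm_of_nonneg (by positivity)]
      refine Real.rpow_le_rpow (norm_nonneg _) ?_ hp0
      have h1 := hB (t₀ * ζ) (by simp [hζ, abs_of_nonneg ht₀.1])
      have h2 := hB (s n * (t₀ * ζ)) (by
        simp only [mem_closedBall_zero_iff, norm_mul, hζ, Complex.norm_real,
          Real.norm_of_nonneg ht₀.1, Real.norm_of_nonneg (hs n).1, mul_one]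
        exact mul_le_of_le_one_left ht₀.1 (hs n).2.le)
      have h3 := norm_add_le (f (s n * (t₀ * ζ))) (f (t₀ * ζ))
      simp only [hg, norm_div, RCLike.norm_ofNat]
      linarith
    · filter_upwards [ae_circleM_mem_sphere] with ζ hζ
      have hmem := mul_mem_ball_of_mem_sphere ht₀ hζ
      have hca : ContinuousAt f (t₀ * ζ) :=
        hf.1.continuousOn.continuousAt (isOpen_ball.mem_nhds hmem)
      have h1 : Filter.Tendsto (fun n => (s n : ℂ) * (t₀ * ζ)) Filter.atTop (nhds (t₀ * ζ)) := by
        have := ((Complex.continuous_ofReal.tendsto 1).comp tendsto_one_sub_inv).mul_const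
          ((t₀ : ℂ) * ζ)
        simp only [Function.comp_def, Complex.ofReal_one, one_mul] at this
        exact this
      have h2 : Filter.Tendsto (fun n => g n (t₀ * ζ)) Filter.atTop (nhds (f (t₀ * ζ))) := by
        have := ((hca.tendsto.comp h1).add_const (f (t₀ * ζ))).div_const 2
        rwa [add_self_div_two] at this
      exact (h2.norm).rpow_const (Or.inr hp0)
  filter_upwards [hlim.eventually_const_lt hAt] with n hn
  have hbig : ∀ t ∈ Set.Ico (0 : ℝ) 1, t₀ ≤ t →
      circleMean p (fun z => f (s n * z) - f z) t ≤ ε := by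
    intro t ht ht₀t
    have hg1 : A - ε / (2 * K) < circleMean p (g n) t :=
      hn.trans_le (circleMean_mono hp (hgd n) ht₀ ht ht₀t)
    have hm1 : circleMean p (fun z => f (s n * z)) t ≤ A := by
      rw [circleMean_dilation]
      exact circleMean_le_hardyNorm_rpow hp hf ⟨mul_nonneg (hs n).1 ht.1,
        mul_lt_one_of_nonneg_of_lt_one_left (hs n).1 (hs n).2 ht.2.le⟩
    have hm2 : circleMean p f t ≤ A := circleMean_le_hardyNorm_rpow hp hf ht
    have hi1 := (continuousOn_norm_rpow_comp_mul hp0 (hfd n).continuousOn ht).integrable_circleM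
    have hi2 := (continuousOn_norm_rpow_comp_mul hp0 hf.1.continuousOn ht).integrable_circleM
    have hi3 := (continuousOn_norm_rpow_comp_mul hp0 (hgd n).continuousOn ht).integrable_circleM
    have hi4 := (continuousOn_norm_rpow_comp_mul hp0 (hdd n).continuousOn ht).integrable_circleM
    have hmain : circleMean p (fun z => f (s n * z) - f z) t ≤
        ε / (4 * (A + 1)) * (circleMean p (fun z => f (s n * z)) t + circleMean p f t) +
        K * ((circleMean p (fun z => f (s n * z)) t + circleMean p f t) / 2
          - circleMean p (g n) t) := by
      have h12 := hi1.add hi2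
      calc _ ≤ _ := integral_mono hi4 ((h12.const_mul (ε / (4 * (A + 1)))).add
            (((h12.div_const 2).sub hi3).const_mul K)) fun ζ => hconv _ _
        _ = _ := by
            rw [integral_add' (h12.const_mul _) (((h12.div_const 2).sub hi3).const_mul K),
              integral_const_mul, integral_const_mul, integral_sub' (h12.div_const 2) hi3,
              integral_div, integral_add' hi1 hi2]
            rfl
    have h1 : ε / (4 * (A + 1)) * (circleMean p (fun z => f (s n * z)) t + circleMean p f t)
        ≤ ε / (4 * (A + 1)) * (2 * (A + 1)) := by
      gcongr
      linarith
    have h2 : ε / (4 * (A + 1)) * (2 * (A + 1)) = ε / 2 := by field_simp; norm_num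
    have h3 : K * ((circleMean p (fun z => f (s n * z)) t + circleMean p f t) / 2
        - circleMean p (g n) t) ≤ K * (ε / (2 * K)) := by
      gcongr
      linarith
    have h4 : K * (ε / (2 * K)) = ε / 2 := by field_simp
    linarith
  have hall : ∀ t ∈ Set.Ico (0 : ℝ) 1, circleMean p (fun z => f (s n * z) - f z) t ≤ ε := by
    intro t ht
    have hmax : max t t₀ ∈ Set.Ico (0 : ℝ) 1 :=
      ⟨ht.1.trans (le_max_left _ _), max_lt ht.2 ht₀.2⟩
    exact (circleMean_mono hp (hdd n) ht hmax (le_max_left _ _)).trans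
      (hbig _ hmax (le_max_right _ _))
  exact ⟨memHp_of_circleMean_le hp (hdd n) hall, hardyNorm_rpow_le hp hall⟩

/-- For `1 < p < ∞`, `h ∈ H^p`, `ψ : 𝔻 → 𝔻` holomorphic with `W_{h,ψ}` bounded
on `H^p`: `W_{h,ψ}` is bounded below iff there is `C > 0` with
`‖W_{h,ψ} k_λ‖_p ≥ C ‖k_λ‖_p` for all `λ ∈ 𝔻`. -/
theorem statement_2 (p : ℝ) (hp : 1 < p) (h ψ : ℂ → ℂ)
    (hh : MemHp p h)
    (hψd : DifferentiableOn ℂ ψ (ball (0 : ℂ) 1))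
    (hψm : Set.MapsTo ψ (ball (0 : ℂ) 1) (ball (0 : ℂ) 1))
    (hbdd : ∃ M > (0 : ℝ), ∀ f : ℂ → ℂ, MemHp p f →
      MemHp p (fun z => h z * f (ψ z)) ∧
      hardyNorm p (fun z => h z * f (ψ z)) ≤ M * hardyNorm p f) :
    (∃ δ > (0 : ℝ), ∀ f : ℂ → ℂ, MemHp p f →
        δ * hardyNorm p f ≤ hardyNorm p (fun z => h z * f (ψ z))) ↔
    (∃ C > (0 : ℝ), ∀ l ∈ ball (0 : ℂ) 1,
        C * hardyNorm p (kern l) ≤ hardyNorm p (fun z => h z * kern l (ψ z))) := by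
  constructor
  · rintro ⟨δ, hδ, hW⟩
    exact ⟨δ, hδ, fun l hl => hW _ (memHp_kern hp (by simpa using hl))⟩
  · rintro ⟨C, hC, hker⟩
    obtain ⟨M, hM, hW⟩ := hbdd
    refine ⟨C, hC, fun f hf => le_of_forall_pos_le_add fun ε hε => ?_⟩
    have hη : 0 < ε / M := by positivity
    have hW0 := hardyNorm_nonneg p (fun z => h z * f (ψ z))
    have hle : C ^ p * hardyNorm p f ^ p ≤
        (hardyNorm p (fun z => h z * f (ψ z)) + ε) ^ p := by
      refine le_of_tendsto ((tendsto_circleMean hp hf).const_mul (C ^ p)) ?_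
      filter_upwards [eventually_hardyNorm_dilation_sub_le hp hf
        (show 0 < (ε / M) ^ p by positivity)] with n hn
      obtain ⟨hmem, hsub⟩ := hn
      have hsn := one_sub_inv_mem_Ico n
      have hsub' := (Real.rpow_le_rpow_iff (hardyNorm_nonneg _ _) hη.le (by linarith)).1 hsub
      refine (circleMean_le_of_kern_bound hp hh hψd hψm (fun g hg => (hW g hg).1) hC.le hker
        hf.1 hsn).trans (Real.rpow_le_rpow (hardyNorm_nonneg _ _) ?_ (by linarith))
      obtain ⟨hWd, hWle⟩ := hW _ hmem
      simp only [mul_sub] at hWd hWle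
      refine (hardyNorm_le_add_hardyNorm_sub hp (hW _ (memHp_dilation hp hf.1 hsn)).1
        (hW f hf).1 hWd).trans (add_le_add le_rfl (hWle.trans ?_))
      calc M * _ ≤ M * (ε / M) := mul_le_mul_of_nonneg_left hsub' hM.le
        _ = ε := mul_div_cancel₀ _ hM.ne'
    rw [← Real.mul_rpow hC.le (hardyNorm_nonneg _ _)] at hle
    exact (Real.rpow_le_rpow_iff (mul_nonneg hC.le (hardyNorm_nonneg _ _)) (by positivity)
      (by linarith)).1 hle

end
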